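/- Well-definedness of the Leray index: let L and L' be continuous paths of Lagrangian subspaces of a real symplectic vector space (E, ω) on [a,b] with L(a) = L'(a) and L(b) = L'(b), and suppose L and L' are homotopic with endpoints fixed, i.e. there is a jointly continuous family (L^s(t))_{s∈[0,1], t∈[a,b]} of Lagrangian subspaces with L^0 = L, L^1 = L', L^s(a) = L(a) and L^s(b) = L(b) for all s. Then [L : const_{L(b)}] = [L' : const_{L(b)}], where const_M denotes the constant path t ↦ M on [a,b]. -/

import Mathlib

open LinearMap (BilinForm)

variable {E : Type*} [NormedAddCommGroup E] [NormedSpace ℝ E]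

/-- A subspace is Lagrangian iff it equals its symplectic orthogonal. -/
def IsLagrangian (ω : BilinForm ℝ E) (L : Submodule ℝ E) : Prop :=
  LinearMap.BilinForm.orthogonal ω L = L

/-- Maximal dimension of a subspace on which the function `Q` is positive away from `0`. -/
noncomputable def posIndex {V : Type*} [AddCommGroup V] [Module ℝ V] (Q : V → ℝ) : ℕ :=
  sSup {d : ℕ | ∃ W : Submodule ℝ V, Module.finrank ℝ W = d ∧ ∀ x ∈ W, x ≠ 0 → 0 < Q x}

/-- The quadratic form `Q(L1,L2,L3)` of a triplet of subspaces,
`Q(x1,x2,x3) = ω(x1,x2) + ω(x2,x3) + ω(x3,x1)`. -/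
def tripleQ (ω : BilinForm ℝ E) (L1 L2 L3 : Submodule ℝ E) (v : L1 × L2 × L3) : ℝ :=
  ω v.1 v.2.1 + ω v.2.1 v.2.2 + ω v.2.2 v.1

/-- The signature `s(L1,L2,L3)` of a triplet of subspaces: the signature (number of positive
squares minus number of negative squares in a diagonalization) of `Q(L1,L2,L3)`. -/
noncomputable def tripleSig (ω : BilinForm ℝ E) (L1 L2 L3 : Submodule ℝ E) : ℤ :=
  (posIndex (tripleQ ω L1 L2 L3) : ℤ) - (posIndex (fun v => - tripleQ ω L1 L2 L3 v) : ℤ)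

/-- A continuous path of Lagrangian subspaces of `(E, ω)` on the interval `[a,b]`:  a family
`(L t)` of Lagrangian subspaces such that every `t0 ∈ [a,b]` has a neighbourhood `U` in `[a,b]`
on which there is a continuous family of idempotent linear maps of `E` with range `L t`. -/
structure IsLagrangianPath (ω : BilinForm ℝ E) (a b : ℝ) (L : ℝ → Submodule ℝ E) : Prop where
  lag : ∀ t ∈ Set.Icc a b, IsLagrangian ω (L t)
  locTriv : ∀ t0 ∈ Set.Icc a b, ∃ U ∈ nhdsWithin t0 (Set.Icc a b), U ⊆ Set.Icc a b ∧
    ∃ P : ℝ → E →L[ℝ] E, ContinuousOn P U ∧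
      ∀ t ∈ U, (P t).comp (P t) = P t ∧ LinearMap.range (P t : E →ₗ[ℝ] E) = L t

/-- A jointly continuous two-parameter family `(L s t)`, `s ∈ [0,1]`, `t ∈ [a,b]`, of Lagrangian
subspaces (a homotopy of paths of Lagrangian subspaces). -/
structure IsLagrangianHomotopy (ω : BilinForm ℝ E) (a b : ℝ)
    (L : ℝ → ℝ → Submodule ℝ E) : Prop where
  lag : ∀ s ∈ Set.Icc (0:ℝ) 1, ∀ t ∈ Set.Icc a b, IsLagrangian ω (L s t)
  locTriv : ∀ p ∈ Set.Icc (0:ℝ) 1 ×ˢ Set.Icc a b,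
    ∃ U ∈ nhdsWithin p (Set.Icc (0:ℝ) 1 ×ˢ Set.Icc a b),
      U ⊆ Set.Icc (0:ℝ) 1 ×ˢ Set.Icc a b ∧
      ∃ P : ℝ × ℝ → E →L[ℝ] E, ContinuousOn P U ∧
        ∀ q ∈ U, (P q).comp (P q) = P q ∧ LinearMap.range (P q : E →ₗ[ℝ] E) = L q.1 q.2

/-- Admissible data for a pair of paths of Lagrangian subspaces on `[a,b]`:  a partition
`a = t_0 ≤ t_1 ≤ … ≤ t_k = b` together with Lagrangian subspaces `M_1, …, M_k` such that
`M_ν ∩ L_i(t) = 0` for all `t ∈ [t_{ν-1}, t_ν]`, `i = 1,2`.  (Here `M (ν+1)` plays the role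
of `M_{ν+1}` for `0 ≤ ν < k`.) -/
structure AdmissibleData (ω : BilinForm ℝ E) (a b : ℝ) (L1 L2 : ℝ → Submodule ℝ E) where
  k : ℕ
  kpos : 0 < k
  t : ℕ → ℝ
  M : ℕ → Submodule ℝ E
  ht0 : t 0 = a
  htk : t k = b
  hmono : ∀ ν < k, t ν ≤ t (ν + 1)
  hlag : ∀ ν < k, IsLagrangian ω (M (ν + 1))
  htrans1 : ∀ ν < k, ∀ s ∈ Set.Icc (t ν) (t (ν + 1)), M (ν + 1) ⊓ L1 s = ⊥
  htrans2 : ∀ ν < k, ∀ s ∈ Set.Icc (t ν) (t (ν + 1)), M (ν + 1) ⊓ L2 s = ⊥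

/-- The expression `(1/2) Σ_ν ( s(L1(t_{ν-1}), L2(t_{ν-1}), M_ν) − s(L1(t_ν), L2(t_ν), M_ν) )`
computed from admissible data; by well-definedness this is the intersection number `[L1 : L2]`. -/
noncomputable def dataSum {ω : BilinForm ℝ E} {a b : ℝ} {L1 L2 : ℝ → Submodule ℝ E}
    (D : AdmissibleData ω a b L1 L2) : ℝ :=
  (1 / 2 : ℝ) * ∑ ν ∈ Finset.range D.k,
    ((tripleSig ω (L1 (D.t ν)) (L2 (D.t ν)) (D.M (ν + 1)) : ℝ)
      - (tripleSig ω (L1 (D.t (ν + 1))) (L2 (D.t (ν + 1))) (D.M (ν + 1)) : ℝ))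

/-- A continuous path of symplectic automorphisms of `(E, ω)` on `[a,b]`. -/
structure IsSymplecticPath (ω : BilinForm ℝ E) (a b : ℝ) (A : ℝ → E →L[ℝ] E) : Prop where
  bij : ∀ t ∈ Set.Icc a b, Function.Bijective (A t)
  symp : ∀ t ∈ Set.Icc a b, ∀ x y, ω (A t x) (A t y) = ω x y
  cont : ContinuousOn A (Set.Icc a b)

/-- The symplectic form of `E × E⁻`: `((x1,x2),(y1,y2)) ↦ ω(x1,y1) − ω(x2,y2)`. -/
noncomputable def prodNegForm (ω : BilinForm ℝ E) : BilinForm ℝ (E × E) :=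
  LinearMap.mk₂ ℝ (fun x y => ω x.1 y.1 - ω x.2 y.2)
    (fun x x' y => by simp only [Prod.fst_add, Prod.snd_add, map_add, LinearMap.add_apply]; ring)
    (fun c x y => by
      simp only [Prod.smul_fst, Prod.smul_snd, map_smul, LinearMap.smul_apply, smul_eq_mul]; ring)
    (fun x y y' => by simp only [Prod.fst_add, Prod.snd_add, map_add]; ring)
    (fun c x y => by simp only [Prod.smul_fst, Prod.smul_snd, map_smul, smul_eq_mul]; ring)

/-- The graph `Γ_A = {(A x, x)}` of an endomorphism, as a subspace of `E × E`. -/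
def graphSub (A : E →L[ℝ] E) : Submodule ℝ (E × E) :=
  LinearMap.range ((A : E →ₗ[ℝ] E).prod LinearMap.id)

/-- The diagonal `Δ = {(x, x)}` in `E × E`. -/
def diagSub : Submodule ℝ (E × E) :=
  LinearMap.range ((LinearMap.id : E →ₗ[ℝ] E).prod LinearMap.id)

open Filter Topology

section Signature

variable {V V' : Type*} [AddCommGroup V] [Module ℝ V] [AddCommGroup V'] [Module ℝ V']

/-- The signature of a real quadratic form. -/
noncomputable def QuadraticForm.signature (Q : QuadraticForm ℝ V) : ℤ :=
  (sigPos Q : ℤ) - (sigNeg Q : ℤ)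

lemma posIndex_eq_sigPos [FiniteDimensional ℝ V] (Q : QuadraticForm ℝ V) :
    posIndex (fun v => Q v) = sigPos Q := by
  refine IsGreatest.csSup_eq ?_
  convert! sigPos_isGreatest Q using 6 with r W
  exact ⟨fun h x hx => h x x.2 (by simpa using hx),
    fun h x hx hx0 => h ⟨x, hx⟩ (by simpa using hx0)⟩

lemma QuadraticForm.signature_eq_of_equiv {Q : QuadraticForm ℝ V} {Q' : QuadraticForm ℝ V'}
    (e : V ≃ₗ[ℝ] V') (h : ∀ v, Q' (e v) = Q v) : Q.signature = Q'.signature := by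
  have hE : QuadraticMap.Equivalent Q Q' := ⟨⟨e, h⟩⟩
  simp only [signature, hE.sigPos_eq, hE.sigNeg_eq]

lemma QuadraticForm.signature_eq_zero_of_neg {Q : QuadraticForm ℝ V}
    (e : V ≃ₗ[ℝ] V) (h : ∀ v, Q (e v) = - Q v) : Q.signature = 0 := by
  have hE : QuadraticMap.Equivalent (-Q) Q := ⟨⟨e, h⟩⟩
  have := hE.sigPos_eq
  rw [sigPos_neg] at this
  simp [signature, this]

lemma finrank_submodule_prod [FiniteDimensional ℝ V] [FiniteDimensional ℝ V']
    (W : Submodule ℝ V) (W' : Submodule ℝ V') :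
    Module.finrank ℝ (W.prod W') = Module.finrank ℝ W + Module.finrank ℝ W' := by
  have h : LinearMap.range (W.subtype.prodMap W'.subtype) = W.prod W' := by
    rw [LinearMap.range_prodMap, Submodule.range_subtype, Submodule.range_subtype]
  rw [← h, LinearMap.finrank_range_of_inj, Module.finrank_prod]
  exact Prod.map_injective.2 ⟨W.subtype_injective, W'.subtype_injective⟩

lemma sigPos_add_le_sigPos_prod [FiniteDimensional ℝ V] [FiniteDimensional ℝ V']
    (Q : QuadraticForm ℝ V) (Q' : QuadraticForm ℝ V') :
    sigPos Q + sigPos Q' ≤ sigPos (Q.prod Q') := by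
  obtain ⟨W, hW, hQ⟩ := exists_finrank_eq_sigPos_and_posDef Q
  obtain ⟨W', hW', hQ'⟩ := exists_finrank_eq_sigPos_and_posDef Q'
  rw [← hW, ← hW', ← finrank_submodule_prod]
  refine le_sigPos_of_posDef _ ?_
  rintro ⟨⟨x, y⟩, hx, hy⟩ hne
  simp only [QuadraticMap.restrict_apply, QuadraticMap.prod_apply]
  rcases eq_or_ne x 0 with rfl | hx0
  · have hy0 : y ≠ 0 := by
      rintro rfl
      exact hne rfl
    simpa using hQ' ⟨y, hy⟩ (by simpa using hy0)
  · have h1 : 0 < Q x := hQ ⟨x, hx⟩ (by simpa using hx0)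
    rcases eq_or_ne y 0 with rfl | hy0
    · simpa using h1
    · have h2 : 0 < Q' y := hQ' ⟨y, hy⟩ (by simpa using hy0)
      positivity

lemma QuadraticForm.signature_prod [FiniteDimensional ℝ V] [FiniteDimensional ℝ V']
    (Q : QuadraticForm ℝ V) (Q' : QuadraticForm ℝ V') :
    signature (Q.prod Q') = Q.signature + Q'.signature := by
  have h1 := sigPos_add_le_sigPos_prod Q Q'
  have h2 := sigPos_add_le_sigPos_prod (-Q) (-Q')
  have h3 : QuadraticMap.prod (-Q) (-Q') = -(Q.prod Q') := by
    ext v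
    simp [add_comm]
  rw [h3] at h2
  simp only [sigPos_neg] at h2
  have h4 := sigPos_add_sigNeg_add_radical (Q := Q)
  have h5 := sigPos_add_sigNeg_add_radical (Q := Q')
  have h6 := sigPos_add_sigNeg_add_radical (Q := Q.prod Q')
  have h7 : Module.finrank ℝ Q.radical + Module.finrank ℝ Q'.radical
      ≤ Module.finrank ℝ (QuadraticMap.radical (Q.prod Q')) := by
    rw [← finrank_submodule_prod]
    refine Submodule.finrank_mono ?_
    rintro ⟨x, y⟩ ⟨hx, hy⟩
    have hx' := QuadraticMap.mem_radical_iff'.1 hx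
    have hy' := QuadraticMap.mem_radical_iff'.1 hy
    refine QuadraticMap.mem_radical_iff'.2 ⟨?_, fun v => ?_⟩
    · simp only [QuadraticMap.prod_apply, hx'.1, hy'.1, add_zero]
    · simp only [QuadraticMap.prod_apply, Prod.fst_add, Prod.snd_add, hx'.2, hy'.2]
  rw [Module.finrank_prod] at h6
  simp only [signature]
  omega

end Signature

section Semicontinuity

variable {X V : Type*} [TopologicalSpace X] [NormedAddCommGroup V] [NormedSpace ℝ V]
  [FiniteDimensional ℝ V]

lemma eventually_sigPos_le {Q : X → QuadraticForm ℝ V} {x₀ : X}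
    (hQ : ∀ v, ContinuousAt (fun p : X × V => Q p.1 p.2) (x₀, v)) :
    ∀ᶠ x in 𝓝 x₀, sigPos (Q x₀) ≤ sigPos (Q x) := by
  obtain ⟨W, hW, hpos⟩ := exists_finrank_eq_sigPos_and_posDef (Q x₀)
  have hK : IsCompact (Metric.sphere (0 : V) 1 ∩ (W : Set V)) :=
    (isCompact_sphere 0 1).inter_right W.closed_of_finiteDimensional
  have key : ∀ᶠ x in 𝓝 x₀, ∀ v ∈ Metric.sphere (0 : V) 1 ∩ (W : Set V), 0 < Q x v := by
    refine hK.eventually_forall_of_forall_eventually fun v hv => ?_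
    have hv0 : (⟨v, hv.2⟩ : W) ≠ 0 := by
      intro h
      have h0 : v = 0 := congrArg Subtype.val h
      have h1 := hv.1
      simp [h0] at h1
    exact (hQ v).eventually_const_lt (hpos _ hv0)
  filter_upwards [key] with x hx
  rw [← hW]
  refine le_sigPos_of_posDef _ ?_
  intro v hv
  have hn : 0 < ‖(v : V)‖ := by simpa using hv
  have h1 := hx (‖(v : V)‖⁻¹ • (v : V)) ⟨by simp [norm_smul, hn.ne'], W.smul_mem _ v.2⟩
  rw [QuadraticMap.map_smul, smul_eq_mul] at h1
  rw [QuadraticMap.restrict_apply]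
  exact pos_of_mul_pos_right h1 (by positivity)

lemma eventually_signature_eq {Q : X → QuadraticForm ℝ V} {x₀ : X}
    (hQ : ∀ v, ContinuousAt (fun p : X × V => Q p.1 p.2) (x₀, v))
    (hr : ∀ᶠ x in 𝓝 x₀, (Q x₀).radical ≤ (Q x).radical) :
    ∀ᶠ x in 𝓝 x₀, (Q x).signature = (Q x₀).signature := by
  have hneg : ∀ v, ContinuousAt (fun p : X × V => (-Q p.1) p.2) (x₀, v) := fun v => (hQ v).neg
  filter_upwards [hr, eventually_sigPos_le hQ,
    eventually_sigPos_le (Q := fun x => -Q x) hneg] with x hx h1 h2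
  have h3 := Submodule.finrank_mono hx
  have h4 := QuadraticForm.sigPos_add_sigNeg_add_radical (Q := Q x)
  have h5 := QuadraticForm.sigPos_add_sigNeg_add_radical (Q := Q x₀)
  simp only [sigPos_neg] at h2
  simp only [QuadraticForm.signature]
  omega

end Semicontinuity

section Algebra

variable {ω : BilinForm ℝ E}

/-- The quadratic form `v ↦ ω (f v) (g v) + ω (g v) (h v) + ω (h v) (f v)`. -/
noncomputable def cyclicForm {V : Type*} [AddCommGroup V] [Module ℝ V] (ω : BilinForm ℝ E)
    (f g h : V →ₗ[ℝ] E) : QuadraticForm ℝ V :=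
  LinearMap.BilinMap.toQuadraticMap (ω.compl₁₂ f g + ω.compl₁₂ g h + ω.compl₁₂ h f)

/-- `tripleQ` as a quadratic form. -/
noncomputable def tripleForm (ω : BilinForm ℝ E) (L1 L2 L3 : Submodule ℝ E) :
    QuadraticForm ℝ (L1 × L2 × L3) :=
  cyclicForm ω (L1.subtype ∘ₗ LinearMap.fst ℝ L1 (L2 × L3))
    (L2.subtype ∘ₗ LinearMap.fst ℝ L2 L3 ∘ₗ LinearMap.snd ℝ L1 (L2 × L3))
    (L3.subtype ∘ₗ LinearMap.snd ℝ L2 L3 ∘ₗ LinearMap.snd ℝ L1 (L2 × L3))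

lemma tripleForm_apply (L1 L2 L3 : Submodule ℝ E) (v : L1 × L2 × L3) :
    tripleForm ω L1 L2 L3 v = tripleQ ω L1 L2 L3 v := rfl

lemma tripleSig_eq_signature [FiniteDimensional ℝ E] (L1 L2 L3 : Submodule ℝ E) :
    tripleSig ω L1 L2 L3 = (tripleForm ω L1 L2 L3).signature := by
  rw [tripleSig, QuadraticForm.signature, ← sigPos_neg, ← posIndex_eq_sigPos,
    ← posIndex_eq_sigPos]
  rfl

lemma eq_zero_of_inf_eq_bot {S T : Submodule ℝ E} (h : S ⊓ T = ⊥) {z : E} (hS : z ∈ S)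
    (hT : z ∈ T) : z = 0 := by
  have hz : z ∈ S ⊓ T := ⟨hS, hT⟩
  simpa [h] using hz

lemma IsLagrangian.apply_eq_zero {L : Submodule ℝ E} (hL : IsLagrangian ω L) {x y : E}
    (hx : x ∈ L) (hy : y ∈ L) : ω x y = 0 := by
  rw [IsLagrangian] at hL
  rw [← hL] at hy
  exact hy x hx

lemma IsLagrangian.mem_of_forall {L : Submodule ℝ E} (hL : IsLagrangian ω L) {y : E}
    (hy : ∀ x ∈ L, ω x y = 0) : y ∈ L := by
  rw [IsLagrangian] at hL
  rw [← hL]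
  exact hy

lemma IsLagrangian.finrank_add_finrank [FiniteDimensional ℝ E] (hnd : ω.Nondegenerate)
    {L : Submodule ℝ E} (hL : IsLagrangian ω L) :
    Module.finrank ℝ L + Module.finrank ℝ L = Module.finrank ℝ E := by
  have h := LinearMap.BilinForm.finrank_orthogonal hnd L
  rw [hL] at h
  have := L.finrank_le
  omega

lemma IsLagrangian.isCompl [FiniteDimensional ℝ E] (hnd : ω.Nondegenerate) {L M : Submodule ℝ E}
    (hL : IsLagrangian ω L) (hM : IsLagrangian ω M) (h : M ⊓ L = ⊥) : IsCompl M L := by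
  have h1 := hL.finrank_add_finrank hnd
  have h2 := hM.finrank_add_finrank hnd
  exact (Submodule.isCompl_iff_disjoint _ _ (by omega)).2 (disjoint_iff.2 h)

/-- A complement `A` of `N` is the graph over any complement of `N` of a map into `N`. -/
lemma exists_graph_map {A B N : Submodule ℝ E} (hA : IsCompl N A) :
    ∃ f : B →ₗ[ℝ] N, ∀ x : B, (x : E) + f x ∈ A := by
  refine ⟨-(N.projectionOnto A hA ∘ₗ B.subtype), fun x => ?_⟩
  have := Submodule.sub_projection_mem hA (x : E)
  simpa [sub_eq_add_neg] using this

/-- If `L2` is parametrized by `V`, with components `f` in `L1` and `g` in `L3`, then the signature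
of the triple is the signature of `v ↦ ω (f v) (g v)`. -/
lemma tripleSig_eq_of_decomposition [FiniteDimensional ℝ E] (halt : LinearMap.IsAlt ω)
    {L1 L2 L3 : Submodule ℝ E} (h1 : IsLagrangian ω L1) (h3 : IsLagrangian ω L3)
    {V : Type*} [AddCommGroup V] [Module ℝ V] [FiniteDimensional ℝ V]
    (e : V ≃ₗ[ℝ] L2) (f : V →ₗ[ℝ] L1) (g : V →ₗ[ℝ] L3) (hfg : ∀ v, (e v : E) = f v + g v)
    (Q : QuadraticForm ℝ V) (hQ : ∀ v, Q v = ω (f v) (g v)) :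
    tripleSig ω L1 L2 L3 = Q.signature := by
  let hyp : QuadraticForm ℝ (L1 × L3) := LinearMap.BilinMap.toQuadraticMap
    (ω.compl₁₂ (L3.subtype ∘ₗ LinearMap.snd ℝ L1 L3) (L1.subtype ∘ₗ LinearMap.fst ℝ L1 L3))
  have hhyp : hyp.signature = 0 := by
    refine QuadraticForm.signature_eq_zero_of_neg
      ((LinearEquiv.refl ℝ L1).prodCongr (LinearEquiv.neg ℝ)) fun v => ?_
    simp [hyp]
  let Φ : (V × (L1 × L3)) →ₗ[ℝ] L1 × L2 × L3 :=
    { toFun := fun v => (v.2.1 + f v.1, e v.1, v.2.2 + g v.1)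
      map_add' := fun v w => by
        ext <;> simp <;> abel
      map_smul' := fun c v => by ext <;> simp }
  let Ψ : L1 × L2 × L3 → (V × (L1 × L3)) :=
    fun v => (e.symm v.2.1, (v.1 - f (e.symm v.2.1), v.2.2 - g (e.symm v.2.1)))
  let Φe : (V × (L1 × L3)) ≃ₗ[ℝ] L1 × L2 × L3 :=
    { Φ with
      invFun := Ψ
      left_inv := fun v => by simp [Φ, Ψ]
      right_inv := fun v => by simp [Φ, Ψ] }
  rw [tripleSig_eq_signature, ← QuadraticForm.signature_eq_of_equiv (Q := Q.prod hyp) Φe,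
    QuadraticForm.signature_prod, hhyp, add_zero]
  rintro ⟨v, x, y⟩
  have hsw : ∀ a b : E, ω a b = - ω b a := fun a b => (halt.neg b a).symm
  change ω (x + f v : L1) (e v) + ω (e v) (y + g v : L3) + ω (y + g v : L3) (x + f v : L1) =
    Q v + ω y x
  rw [hfg, hQ]
  simp only [Submodule.coe_add, map_add, LinearMap.add_apply]
  rw [h1.apply_eq_zero x.2 (f v).2, h1.apply_eq_zero (f v).2 (f v).2,
    h3.apply_eq_zero (g v).2 y.2, h3.apply_eq_zero (g v).2 (g v).2, hsw y (f v), hsw (g v) x,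
    hsw (g v) (f v)]
  ring

lemma tripleSig_sub_eq [FiniteDimensional ℝ E] (halt : LinearMap.IsAlt ω) (hnd : ω.Nondegenerate)
    {A B M N : Submodule ℝ E} (hA : IsLagrangian ω A) (hB : IsLagrangian ω B)
    (hM : IsLagrangian ω M) (hN : IsLagrangian ω N) (hMA : M ⊓ A = ⊥) (hMB : M ⊓ B = ⊥)
    (hNA : N ⊓ A = ⊥) (hNB : N ⊓ B = ⊥) :
    tripleSig ω A B M - tripleSig ω A B N = tripleSig ω A N M - tripleSig ω B N M := by
  obtain ⟨α, hα⟩ := exists_graph_map (B := B) (hA.isCompl hnd hN hNA)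
  obtain ⟨μ, hμ⟩ := exists_graph_map (B := N)
    (hM.isCompl hnd hB (by rw [inf_comm]; exact hMB))
  -- the parametrizations by which `B` and `N` are decomposed along `A` and `M`
  have inj1 : Function.Injective (LinearMap.id - μ ∘ₗ α : B →ₗ[ℝ] B) := by
    rw [← LinearMap.ker_eq_bot, LinearMap.ker_eq_bot']
    intro x hx
    have h1 : x = μ (α x) := by simpa [sub_eq_zero] using hx
    have h2 := eq_zero_of_inf_eq_bot hMA (by simpa [add_comm, ← h1] using hμ (α x)) (hα x)
    have h3 := eq_zero_of_inf_eq_bot hNB (z := (x : E))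
      (by rw [eq_neg_of_add_eq_zero_left h2]; exact N.neg_mem (α x).2) x.2
    simpa using h3
  have inj2 : Function.Injective (α ∘ₗ μ - LinearMap.id : N →ₗ[ℝ] N) := by
    rw [← LinearMap.ker_eq_bot, LinearMap.ker_eq_bot']
    intro x hx
    have h1 : α (μ x) = x := by simpa [sub_eq_zero] using hx
    have h2 := eq_zero_of_inf_eq_bot hMA (hμ x) (by simpa [add_comm, h1] using hα (μ x))
    have h3 := eq_zero_of_inf_eq_bot hNB (z := (x : E)) x.2
      (by rw [eq_neg_of_add_eq_zero_left h2]; exact B.neg_mem (μ x).2)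
    simpa using h3
  obtain ⟨iA, hiA⟩ : ∃ i : B →ₗ[ℝ] A, ∀ x : B, (i x : E) = x + α x :=
    ⟨(B.subtype + N.subtype ∘ₗ α).codRestrict A hα, fun _ => rfl⟩
  obtain ⟨iM, hiM⟩ : ∃ i : N →ₗ[ℝ] M, ∀ x : N, (i x : E) = x + μ x :=
    ⟨(N.subtype + B.subtype ∘ₗ μ).codRestrict M hμ, fun _ => rfl⟩
  let form {V S T : Submodule ℝ E} (f : V →ₗ[ℝ] S) (g : V →ₗ[ℝ] T) : QuadraticForm ℝ V :=
    LinearMap.BilinMap.toQuadraticMap (ω.compl₁₂ (S.subtype ∘ₗ f) (T.subtype ∘ₗ g))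
  have s1 : tripleSig ω A B M = (form iA (-(iM ∘ₗ α))).signature :=
    tripleSig_eq_of_decomposition halt hA hM (LinearEquiv.ofInjectiveEndo _ inj1) iA
      (-(iM ∘ₗ α)) (fun x => by simp [hiA, hiM]; abel) _ fun _ => rfl
  have s2 : tripleSig ω A B N = (form iA (-α)).signature :=
    tripleSig_eq_of_decomposition halt hA hN (LinearEquiv.refl ℝ B) iA (-α)
      (fun x => by simp [hiA]) _ fun _ => rfl
  have s3 : tripleSig ω A N M = (form (iA ∘ₗ μ) (-iM)).signature :=
    tripleSig_eq_of_decomposition halt hA hM (LinearEquiv.ofInjectiveEndo _ inj2) (iA ∘ₗ μ)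
      (-iM) (fun x => by simp [hiA, hiM]; abel) _ fun _ => rfl
  have s4 : tripleSig ω B N M = (form (-μ) iM).signature :=
    tripleSig_eq_of_decomposition halt hB hM (LinearEquiv.refl ℝ N) (-μ) iM
      (fun x => by simp [hiM]) _ fun _ => rfl
  have hsum : (form iA (-(iM ∘ₗ α))).signature + (form (-μ) iM).signature =
      (form iA (-α)).signature + (form (iA ∘ₗ μ) (-iM)).signature := by
    let e1 : (B × N) ≃ₗ[ℝ] B × N := (LinearEquiv.refl ℝ B).skewProd (LinearEquiv.refl ℝ N) α
    let e2 : (B × N) ≃ₗ[ℝ] B × N := LinearEquiv.prodComm ℝ B N ≪≫ₗ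
      (LinearEquiv.refl ℝ N).skewProd (LinearEquiv.refl ℝ B) μ ≪≫ₗ LinearEquiv.prodComm ℝ N B
    rw [← QuadraticForm.signature_prod, ← QuadraticForm.signature_prod]
    refine QuadraticForm.signature_eq_of_equiv (e1.symm ≪≫ₗ e2) fun v => ?_
    obtain ⟨⟨x, n⟩, rfl⟩ := e1.surjective v
    have hsw : ∀ a b : E, ω a b = - ω b a := fun a b => (halt.neg b a).symm
    have r1 := hA.apply_eq_zero (iA x).2 (iA (μ n)).2
    have r2 := hM.apply_eq_zero (iM n).2 (iM (α x)).2
    simp only [hiA, hiM, map_add, LinearMap.add_apply,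
      hB.apply_eq_zero x.2 (μ n).2, hN.apply_eq_zero (α x).2 (α (μ n)).2,
      hN.apply_eq_zero n.2 (α x).2, hB.apply_eq_zero (μ n).2 (μ (α x)).2] at r1 r2
    rw [LinearEquiv.trans_apply, LinearEquiv.symm_apply_apply]
    change ω (iA (x + μ n)) (-α (x + μ n) : N) + ω (iA (μ n)) (-iM n : M) =
      ω (iA x) (-iM (α x) : M) + ω (-μ (n + α x) : B) (iM (n + α x))
    simp only [hiA, hiM, map_add, LinearMap.add_apply, Submodule.coe_add, Submodule.coe_neg,
      map_neg, LinearMap.neg_apply, hN.apply_eq_zero (α x).2 (α x).2,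
      hN.apply_eq_zero (α x).2 (α (μ n)).2, hN.apply_eq_zero (α (μ n)).2 (α x).2,
      hN.apply_eq_zero (α (μ n)).2 (α (μ n)).2, hN.apply_eq_zero (α (μ n)).2 n.2,
      hB.apply_eq_zero (μ n).2 (μ n).2, hB.apply_eq_zero x.2 (μ (α x)).2,
      hB.apply_eq_zero (μ n).2 (μ (α x)).2, hB.apply_eq_zero (μ (α x)).2 (μ n).2,
      hB.apply_eq_zero (μ (α x)).2 (μ (α x)).2]
    linarith [hsw (α x) (μ n), hsw (α (μ n)) (μ n), hsw (α x) (μ (α x)), hsw n (μ (α x)),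
      hsw n (μ n)]
  rw [s1, s2, s3, s4]
  linarith

lemma mem_radical_tripleForm_of_eq (halt : LinearMap.IsAlt ω) {A N M : Submodule ℝ E}
    (hN : IsLagrangian ω N) (hM : IsLagrangian ω M) {v : A × N × M} (h1 : v.1 = 0)
    (h2 : (v.2.1 : E) = v.2.2) : v ∈ (tripleForm ω A N M).radical := by
  obtain ⟨a, n, m⟩ := v
  obtain rfl : a = 0 := h1
  have h2 : (n : E) = m := h2
  refine QuadraticMap.mem_radical_iff'.2 ⟨?_, ?_⟩
  · simp [tripleForm_apply, tripleQ, h2, halt.self_eq_zero]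
  · rintro ⟨a', n', m'⟩
    have e1 := hN.apply_eq_zero n'.2 n.2
    have e2 := hM.apply_eq_zero m.2 m'.2
    have e3 := halt.neg (a' : E) m
    simp only [tripleForm_apply, tripleQ, Prod.mk_add_mk, Submodule.coe_add, map_add,
      LinearMap.add_apply, h2, halt.self_eq_zero, zero_add] at e1 ⊢
    linarith

lemma eq_of_mem_radical_tripleForm (halt : LinearMap.IsAlt ω) {A N M : Submodule ℝ E}
    (hA : IsLagrangian ω A) (hN : IsLagrangian ω N) (hM : IsLagrangian ω M)
    (hNA : N ⊓ A = ⊥) (hMA : M ⊓ A = ⊥) {v : A × N × M}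
    (hv : v ∈ (tripleForm ω A N M).radical) : v.1 = 0 ∧ (v.2.1 : E) = v.2.2 := by
  obtain ⟨a, n, m⟩ := v
  obtain ⟨hv0, hv⟩ := QuadraticMap.mem_radical_iff'.1 hv
  simp only [tripleForm_apply, tripleQ] at hv0
  have h1 : (n : E) - m ∈ A := hA.mem_of_forall fun x hx => by
    have h := hv (⟨x, hx⟩, 0, 0)
    have e := halt.neg x (m : E)
    simp only [tripleForm_apply, tripleQ, Prod.mk_add_mk, Submodule.coe_add, map_add, map_zero,
      LinearMap.add_apply, LinearMap.zero_apply, ZeroMemClass.coe_zero, add_zero] at h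
    rw [map_sub]
    linarith
  have h2 : (m : E) - a ∈ N := hN.mem_of_forall fun x hx => by
    have h := hv (0, ⟨x, hx⟩, 0)
    have e := halt.neg x (a : E)
    simp only [tripleForm_apply, tripleQ, Prod.mk_add_mk, Submodule.coe_add, map_add, map_zero,
      LinearMap.add_apply, LinearMap.zero_apply, ZeroMemClass.coe_zero, add_zero] at h
    rw [map_sub]
    linarith
  have h3 : (a : E) - n ∈ M := hM.mem_of_forall fun x hx => by
    have h := hv (0, 0, ⟨x, hx⟩)
    have e := halt.neg x (n : E)
    simp only [tripleForm_apply, tripleQ, Prod.mk_add_mk, Submodule.coe_add, map_add, map_zero,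
      LinearMap.add_apply, LinearMap.zero_apply, ZeroMemClass.coe_zero, add_zero] at h
    rw [map_sub]
    linarith
  have h4 : (a : E) + (n - m) = 0 := by
    refine eq_zero_of_inf_eq_bot hNA ?_ (A.add_mem a.2 h1)
    convert N.sub_mem n.2 h2 using 1
    abel
  have h5 : (a : E) - (n - m) = 0 := by
    refine eq_zero_of_inf_eq_bot hMA ?_ (A.sub_mem a.2 h1)
    convert M.add_mem m.2 h3 using 1
    abel
  have h6 : (a : E) = 0 := by
    have h : (2 : ℝ) • (a : E) = ((a : E) + (n - m)) + (a - (n - m)) := by rw [two_smul]; abel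
    rw [h4, h5, add_zero] at h
    simpa using h
  refine ⟨by simpa using h6, ?_⟩
  rw [h6, zero_add] at h4
  exact sub_eq_zero.1 h4

end Algebra

section Local

variable {X : Type*} [TopologicalSpace X] {ω : BilinForm ℝ E}

/-- Near `x₀`, the family of subspaces `A` is the range of a family of idempotents continuous
at `x₀`. -/
def ContinuousSubspaceAt (A : X → Submodule ℝ E) (x₀ : X) : Prop :=
  ∃ P : X → E →L[ℝ] E, ContinuousAt P x₀ ∧ ∀ᶠ x in 𝓝 x₀,
    (P x).comp (P x) = P x ∧ LinearMap.range (P x : E →ₗ[ℝ] E) = A x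

lemma ContinuousSubspaceAt.comp {Y : Type*} [TopologicalSpace Y] {A : X → Submodule ℝ E}
    {f : Y → X} {y : Y} (hA : ContinuousSubspaceAt A (f y)) (hf : ContinuousAt f y) :
    ContinuousSubspaceAt (fun z => A (f z)) y := by
  obtain ⟨P, hP, h⟩ := hA
  exact ⟨fun z => P (f z), hP.comp hf, hf.eventually h⟩

lemma apply_eq_self_of_mem_range {P : E →L[ℝ] E} {A : Submodule ℝ E} (hP : P.comp P = P)
    (hA : LinearMap.range (P : E →ₗ[ℝ] E) = A) {a : E} (ha : a ∈ A) : P a = a := by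
  rw [← hA] at ha
  obtain ⟨y, rfl⟩ := ha
  exact congrArg (fun T : E →L[ℝ] E => T y) hP

lemma ContinuousSubspaceAt.eventually_inf_eq_bot [FiniteDimensional ℝ E] {A : X → Submodule ℝ E}
    {x₀ : X} (hA : ContinuousSubspaceAt A x₀) {M : Submodule ℝ E} (h : M ⊓ A x₀ = ⊥) :
    ∀ᶠ x in 𝓝 x₀, M ⊓ A x = ⊥ := by
  obtain ⟨P, hP, hPA⟩ := hA
  obtain ⟨hid, hran⟩ := hPA.self_of_nhds
  let g : M →ₗ[ℝ] E := (LinearMap.id - (P x₀ : E →ₗ[ℝ] E)) ∘ₗ M.subtype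
  have hg : LinearMap.ker g = ⊥ := by
    rw [LinearMap.ker_eq_bot']
    intro m hm
    have h1 : (m : E) = P x₀ m := by simpa [g, sub_eq_zero] using hm
    have h2 : (m : E) ∈ A x₀ := by
      rw [← hran, h1]
      exact LinearMap.mem_range_self (P x₀ : E →ₗ[ℝ] E) m
    simpa using eq_zero_of_inf_eq_bot h m.2 h2
  obtain ⟨K, hK, hanti⟩ := g.exists_antilipschitzWith hg
  have hK' : (0 : ℝ) < K := hK
  have hclose := Metric.tendsto_nhds.1 hP (K : ℝ)⁻¹ (by positivity)
  filter_upwards [hPA, hclose] with x hx hxc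
  rw [dist_eq_norm] at hxc
  rw [Submodule.eq_bot_iff]
  rintro z ⟨hzM, hzA⟩
  by_contra hz
  have hz' : 0 < ‖z‖ := norm_pos_iff.2 hz
  have h1 := apply_eq_self_of_mem_range hx.1 hx.2 hzA
  have h2 : ‖z‖ ≤ K * ‖g ⟨z, hzM⟩‖ := by
    have := hanti.le_mul_dist ⟨z, hzM⟩ 0
    simpa [dist_eq_norm] using this
  have h3 : g ⟨z, hzM⟩ = (P x - P x₀) z := by simp [g, h1]
  rw [h3] at h2
  have h4 : ‖(P x - P x₀) z‖ < (K : ℝ)⁻¹ * ‖z‖ :=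
    ((P x - P x₀).le_opNorm z).trans_lt (by gcongr)
  have h5 : K * ‖(P x - P x₀) z‖ < K * ((K : ℝ)⁻¹ * ‖z‖) := by gcongr
  rw [mul_inv_cancel_left₀ hK'.ne'] at h5
  linarith

lemma ContinuousSubspaceAt.eventually_tripleSig_eq [FiniteDimensional ℝ E]
    (halt : LinearMap.IsAlt ω) (hnd : ω.Nondegenerate) {A : X → Submodule ℝ E} {x₀ : X}
    (hA : ContinuousSubspaceAt A x₀) (hlag : ∀ x, IsLagrangian ω (A x)) {N M : Submodule ℝ E}
    (hN : IsLagrangian ω N) (hM : IsLagrangian ω M)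
    (hNA : N ⊓ A x₀ = ⊥) (hMA : M ⊓ A x₀ = ⊥) :
    ∀ᶠ x in 𝓝 x₀, tripleSig ω (A x) N M = tripleSig ω (A x₀) N M := by
  obtain ⟨P, hP, hPA⟩ := hA
  obtain ⟨hid, hran⟩ := hPA.self_of_nhds
  let p1 := (A x₀).subtype ∘ₗ LinearMap.fst ℝ (A x₀) (N × M)
  let p2 := N.subtype ∘ₗ LinearMap.fst ℝ N M ∘ₗ LinearMap.snd ℝ (A x₀) (N × M)
  let p3 := M.subtype ∘ₗ LinearMap.snd ℝ N M ∘ₗ LinearMap.snd ℝ (A x₀) (N × M)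
  let Q : X → QuadraticForm ℝ (A x₀ × N × M) :=
    fun x => cyclicForm ω ((P x : E →ₗ[ℝ] E) ∘ₗ p1) p2 p3
  have hQ0 : Q x₀ = tripleForm ω (A x₀) N M := by
    ext ⟨a, n, m⟩
    have ha := apply_eq_self_of_mem_range hid hran a.2
    change ω (P x₀ a) n + ω n m + ω m (P x₀ a) = ω a n + ω n m + ω m a
    rw [ha]
  have hω : Continuous fun q : E × E => ω q.1 q.2 := ω.toContinuousBilinearMap.continuous₂
  have hcont : ∀ v, ContinuousAt (fun p : X × (A x₀ × N × M) => Q p.1 p.2) (x₀, v) := by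
    intro v
    have c1 : ContinuousAt (fun p : X × (A x₀ × N × M) => P p.1 (p.2.1 : E)) (x₀, v) :=
      ContinuousAt.clm_apply (ContinuousAt.comp (f := Prod.fst) hP continuousAt_fst)
        (by fun_prop)
    have c2 : ContinuousAt (fun p : X × (A x₀ × N × M) => (p.2.2.1 : E)) (x₀, v) := by fun_prop
    have c3 : ContinuousAt (fun p : X × (A x₀ × N × M) => (p.2.2.2 : E)) (x₀, v) := by fun_prop
    exact ((hω.continuousAt.comp (c1.prodMk c2)).add (hω.continuousAt.comp (c2.prodMk c3))).add
      (hω.continuousAt.comp (c3.prodMk c1))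
  have hequiv : ∀ᶠ x in 𝓝 x₀, ∃ e : (A x₀ × N × M) ≃ₗ[ℝ] A x × N × M,
      (∀ v, tripleForm ω (A x) N M (e v) = Q x v) ∧ (∀ v, v.1 = 0 → (e v).1 = 0) ∧
      ∀ v, (e v).2 = v.2 := by
    have hclose := Metric.tendsto_nhds.1 hP 1 one_pos
    filter_upwards [hPA, hclose] with x hx hxc
    rw [dist_eq_norm] at hxc
    let f : A x₀ →ₗ[ℝ] A x := ((P x : E →ₗ[ℝ] E) ∘ₗ (A x₀).subtype).codRestrict (A x)
      fun a => by rw [← hx.2]; exact LinearMap.mem_range_self (P x : E →ₗ[ℝ] E) a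
    have hf : Function.Injective f := by
      rw [← LinearMap.ker_eq_bot, LinearMap.ker_eq_bot']
      intro a ha
      have h1 : P x a = 0 := congrArg Subtype.val ha
      have h2 := apply_eq_self_of_mem_range hid hran a.2
      have h3 := (P x - P x₀).le_opNorm (a : E)
      rw [sub_apply, h1, h2, zero_sub, norm_neg] at h3
      by_contra hne
      have h4 : 0 < ‖(a : E)‖ := norm_pos_iff.2 (by simpa using hne)
      nlinarith
    have hdim : Module.finrank ℝ (A x₀) = Module.finrank ℝ (A x) := by
      have h1 := (hlag x₀).finrank_add_finrank hnd
      have h2 := (hlag x).finrank_add_finrank hnd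
      omega
    let e := LinearEquiv.ofInjectiveOfFinrankEq f hf hdim
    refine ⟨e.prodCongr (LinearEquiv.refl ℝ _), fun v => rfl, ?_, fun v => rfl⟩
    intro v hv
    change e v.1 = 0
    rw [hv, map_zero]
  have hrad : ∀ᶠ x in 𝓝 x₀, (Q x₀).radical ≤ (Q x).radical := by
    filter_upwards [hequiv] with x ⟨e, he, he1, he2⟩ v hv
    rw [hQ0] at hv
    obtain ⟨h1, h2⟩ := eq_of_mem_radical_tripleForm halt (hlag x₀) hN hM hNA hMA hv
    have h3 : e v ∈ (tripleForm ω (A x) N M).radical :=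
      mem_radical_tripleForm_of_eq halt hN hM (he1 v h1) (by rw [he2]; exact h2)
    rw [QuadraticMap.mem_radical_iff'] at h3 ⊢
    refine ⟨by rw [← he, h3.1], fun w => ?_⟩
    rw [← he, map_add, h3.2, he]
  filter_upwards [hequiv, eventually_signature_eq hcont hrad] with x ⟨e, he, _⟩ hx
  rw [tripleSig_eq_signature, tripleSig_eq_signature, ← hQ0, ← hx]
  exact (QuadraticForm.signature_eq_of_equiv e he).symm

/-- Changing the auxiliary Lagrangian changes the signature by a locally constant amount. -/
lemma ContinuousSubspaceAt.eventually_tripleSig_sub_eq [FiniteDimensional ℝ E]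
    (halt : LinearMap.IsAlt ω) (hnd : ω.Nondegenerate) {A : X → Submodule ℝ E} {x₀ : X}
    (hA : ContinuousSubspaceAt A x₀) (hlag : ∀ x, IsLagrangian ω (A x)) {B N M : Submodule ℝ E}
    (hB : IsLagrangian ω B) (hN : IsLagrangian ω N) (hM : IsLagrangian ω M)
    (hNA : N ⊓ A x₀ = ⊥) (hMA : M ⊓ A x₀ = ⊥) (hNB : N ⊓ B = ⊥) (hMB : M ⊓ B = ⊥) :
    ∀ᶠ x in 𝓝 x₀, tripleSig ω (A x) B M - tripleSig ω (A x) B N =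
      tripleSig ω (A x₀) B M - tripleSig ω (A x₀) B N := by
  filter_upwards [hA.eventually_tripleSig_eq halt hnd hlag hN hM hNA hMA,
    hA.eventually_inf_eq_bot hNA, hA.eventually_inf_eq_bot hMA] with x h1 h2 h3
  rw [tripleSig_sub_eq halt hnd (hlag x) hB hM hN h3 hMB h2 hNB,
    tripleSig_sub_eq halt hnd (hlag x₀) hB hM hN hMA hMB hNA hNB, h1]

end Local

section Families

variable {ω : BilinForm ℝ E}

lemma continuousSubspaceAt_of_nhdsWithin {Y : Type*} [TopologicalSpace Y] {S U : Set Y}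
    {A : Y → Submodule ℝ E} {y : Y} (hy : y ∈ S) (hU : U ∈ 𝓝[S] y) {P : Y → E →L[ℝ] E}
    (hP : ContinuousOn P U) (hPA : ∀ z ∈ U, (P z).comp (P z) = P z ∧
      LinearMap.range (P z : E →ₗ[ℝ] E) = A z) :
    ContinuousSubspaceAt (fun z : S => A z) ⟨y, hy⟩ := by
  have hU' : Subtype.val ⁻¹' U ∈ 𝓝 (⟨y, hy⟩ : S) := by
    rw [nhds_subtype_eq_comap_nhdsWithin]
    exact preimage_mem_comap hU
  refine ⟨fun z => P z, ?_, eventually_of_mem hU' fun z hz => hPA z hz⟩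
  have h : Tendsto P (𝓝[U] y) (𝓝 (P y)) := hP y (mem_of_mem_nhdsWithin hy hU)
  refine h.comp (tendsto_nhdsWithin_iff.2 ⟨continuousAt_subtype_val, hU'⟩)

lemma IsLagrangianPath.continuousSubspaceAt {a b : ℝ} {A : ℝ → Submodule ℝ E}
    (hA : IsLagrangianPath ω a b A) (t : Set.Icc a b) :
    ContinuousSubspaceAt (fun t : Set.Icc a b => A t) t := by
  obtain ⟨U, hU, -, P, hP, hPA⟩ := hA.locTriv t t.2
  exact continuousSubspaceAt_of_nhdsWithin t.2 hU hP hPA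

lemma IsLagrangianHomotopy.continuousSubspaceAt {a b : ℝ} {H : ℝ → ℝ → Submodule ℝ E}
    (hH : IsLagrangianHomotopy ω a b H) (p : Set.Icc (0 : ℝ) 1 × Set.Icc a b) :
    ContinuousSubspaceAt (fun p : Set.Icc (0 : ℝ) 1 × Set.Icc a b => H p.1 p.2) p := by
  have hp : ((p.1 : ℝ), (p.2 : ℝ)) ∈ Set.Icc (0 : ℝ) 1 ×ˢ Set.Icc a b := ⟨p.1.2, p.2.2⟩
  obtain ⟨U, hU, -, P, hP, hPA⟩ := hH.locTriv _ hp
  exact (continuousSubspaceAt_of_nhdsWithin (A := fun q => H q.1 q.2) hp hU hP hPA).comp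
    (f := fun q : Set.Icc (0 : ℝ) 1 × Set.Icc a b =>
      (⟨(q.1, q.2), q.1.2, q.2.2⟩ : ↥(Set.Icc (0 : ℝ) 1 ×ˢ Set.Icc a b)))
    (by fun_prop)

end Families

section Transversal

variable {ω : BilinForm ℝ E}

lemma mem_sup_of_add_mem {M L : Submodule ℝ E} (hML : M ⊓ L = ⊥) {x : E}
    (hMx : M ≤ ω.orthogonal M) (hx : x ∈ ω.orthogonal M) (hxL : x ∉ L ⊓ ω.orthogonal M ⊔ M) :
    (M ⊔ Submodule.span ℝ {x}) ⊓ L = ⊥ := by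
  rw [Submodule.eq_bot_iff]
  rintro z ⟨hz, hzL⟩
  obtain ⟨m, hm, y, hy, rfl⟩ := Submodule.mem_sup.1 hz
  obtain ⟨c, rfl⟩ := Submodule.mem_span_singleton.1 hy
  by_cases hc : c = 0
  · subst hc
    rw [zero_smul, add_zero] at hzL ⊢
    exact eq_zero_of_inf_eq_bot hML hm hzL
  · refine absurd ?_ hxL
    have h : x = c⁻¹ • (m + c • x) + (-(c⁻¹ • m)) := by
      rw [smul_add, inv_smul_smul₀ hc]; abel
    rw [h]
    refine Submodule.add_mem_sup (Submodule.smul_mem _ _ ⟨hzL, ?_⟩)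
      (Submodule.neg_mem _ (Submodule.smul_mem _ _ hm))
    exact Submodule.add_mem _ (hMx hm) (Submodule.smul_mem _ _ hx)

lemma IsLagrangian.exists_notMem_sup [FiniteDimensional ℝ E] (halt : LinearMap.IsAlt ω)
    (hnd : ω.Nondegenerate) {L M : Submodule ℝ E} (hL : IsLagrangian ω L) (hML : M ⊓ L = ⊥)
    (hM : M ≤ ω.orthogonal M) (hne : ¬ IsLagrangian ω M) :
    ∃ x ∈ ω.orthogonal M, x ∉ L ⊓ ω.orthogonal M ⊔ M := by
  by_contra! hcon
  have key : L ⊓ ω.orthogonal M = ⊥ := by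
    rw [Submodule.eq_bot_iff]
    rintro z ⟨hzL, hzM⟩
    refine eq_zero_of_inf_eq_bot hML ?_ hzL
    rw [← LinearMap.BilinForm.orthogonal_orthogonal hnd halt.isRefl M]
    intro y hy
    obtain ⟨l, hl, m, hm, rfl⟩ := Submodule.mem_sup.1 (hcon y hy)
    change ω (l + m) z = 0
    rw [map_add, LinearMap.add_apply, hL.apply_eq_zero hl.1 hzL, zero_add]
    exact hzM m hm
  rw [key, bot_sup_eq] at hcon
  exact hne (le_antisymm hcon hM)

/-- Two Lagrangian subspaces have a common Lagrangian complement. -/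
lemma IsLagrangian.exists_transversal [FiniteDimensional ℝ E] (halt : LinearMap.IsAlt ω)
    (hnd : ω.Nondegenerate) {L B : Submodule ℝ E} (hL : IsLagrangian ω L)
    (hB : IsLagrangian ω B) :
    ∃ M, IsLagrangian ω M ∧ M ⊓ L = ⊥ ∧ M ⊓ B = ⊥ := by
  obtain ⟨M, ⟨hM, hML, hMB⟩, hmax⟩ := WellFounded.has_min
    (wellFounded_gt (α := Submodule ℝ E))
    {M | M ≤ ω.orthogonal M ∧ M ⊓ L = ⊥ ∧ M ⊓ B = ⊥} ⟨⊥, bot_le, bot_inf_eq _, bot_inf_eq _⟩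
  refine ⟨M, ?_, hML, hMB⟩
  by_contra hne
  obtain ⟨x, hx, hxL⟩ := hL.exists_notMem_sup halt hnd hML hM hne
  obtain ⟨y, hy, hyB⟩ := hB.exists_notMem_sup halt hnd hMB hM hne
  obtain ⟨z, hz, hzL, hzB⟩ : ∃ z ∈ ω.orthogonal M,
      z ∉ L ⊓ ω.orthogonal M ⊔ M ∧ z ∉ B ⊓ ω.orthogonal M ⊔ M := by
    by_cases hxB : x ∈ B ⊓ ω.orthogonal M ⊔ M
    · by_cases hyL : y ∈ L ⊓ ω.orthogonal M ⊔ M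
      · exact ⟨x + y, add_mem hx hy, fun h => hxL ((Submodule.add_mem_iff_left _ hyL).1 h),
          fun h => hyB ((Submodule.add_mem_iff_right _ hxB).1 h)⟩
      · exact ⟨y, hy, hyL, hyB⟩
    · exact ⟨x, hx, hxL, hxB⟩
  refine hmax (M ⊔ Submodule.span ℝ {z}) ⟨?_, mem_sup_of_add_mem hML hM hz hzL,
    mem_sup_of_add_mem hMB hM hz hzB⟩ ?_
  · intro u hu v hv
    obtain ⟨m, hm, p, hp, rfl⟩ := Submodule.mem_sup.1 hu
    obtain ⟨n, hn, q, hq, rfl⟩ := Submodule.mem_sup.1 hv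
    obtain ⟨c, rfl⟩ := Submodule.mem_span_singleton.1 hp
    obtain ⟨d, rfl⟩ := Submodule.mem_span_singleton.1 hq
    have h1 : ω n m = 0 := hM hm n hn
    have h2 : ω n z = 0 := hz n hn
    have h3 : ω z m = 0 := halt.isRefl _ _ (hz m hm)
    have h4 : ω z z = 0 := halt z
    change ω (n + d • z) (m + c • z) = 0
    simp [h1, h2, h3, h4]
  · refine lt_of_le_of_ne le_sup_left fun h => hzL (Submodule.mem_sup_right ?_)
    rw [h]
    exact Submodule.mem_sup_right (Submodule.mem_span_singleton_self z)

end Transversal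

section Segment

variable {ω : BilinForm ℝ E}

/-- On a segment where `M` and `N` both stay transverse to the path, they compute the same
increment. -/
lemma tripleSig_sub_eq_of_transverse [FiniteDimensional ℝ E] (halt : LinearMap.IsAlt ω)
    (hnd : ω.Nondegenerate) {a b : ℝ} {A : ℝ → Submodule ℝ E} (hA : IsLagrangianPath ω a b A)
    {B N M : Submodule ℝ E} (hB : IsLagrangian ω B) (hN : IsLagrangian ω N)
    (hM : IsLagrangian ω M) (hNB : N ⊓ B = ⊥) (hMB : M ⊓ B = ⊥) {u v : ℝ} (hau : a ≤ u)
    (huv : u ≤ v) (hvb : v ≤ b) (hNA : ∀ t ∈ Set.Icc u v, N ⊓ A t = ⊥)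
    (hMA : ∀ t ∈ Set.Icc u v, M ⊓ A t = ⊥) :
    tripleSig ω (A u) B M - tripleSig ω (A v) B M =
      tripleSig ω (A u) B N - tripleSig ω (A v) B N := by
  have hsub : ∀ t ∈ Set.Icc u v, t ∈ Set.Icc a b := fun t ht => ⟨hau.trans ht.1, ht.2.trans hvb⟩
  have : PreconnectedSpace (Set.Icc u v) := Subtype.preconnectedSpace isPreconnected_Icc
  have hloc : IsLocallyConstant fun t : Set.Icc u v =>
      tripleSig ω (A t) B M - tripleSig ω (A t) B N := by
    rw [IsLocallyConstant.iff_eventually_eq]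
    intro t
    refine ContinuousSubspaceAt.eventually_tripleSig_sub_eq (A := fun t : Set.Icc u v => A t)
      halt hnd ?_ (fun t => hA.lag t (hsub t t.2)) hB hN hM (hNA t t.2) (hMA t t.2) hNB hMB
    have h := hA.continuousSubspaceAt ⟨t, hsub t t.2⟩
    exact h.comp (f := fun t : Set.Icc u v => (⟨t, hsub t t.2⟩ : Set.Icc a b))
      (by fun_prop)
  have := hloc.apply_eq_of_preconnectedSpace ⟨u, le_rfl, huv⟩ ⟨v, huv, le_rfl⟩
  simp only at this
  linarith

end Segment

section Independence

variable {ω : BilinForm ℝ E} {a b : ℝ}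

lemma AdmissibleData.t_le_t {L1 L2 : ℝ → Submodule ℝ E} (D : AdmissibleData ω a b L1 L2)
    {i j : ℕ} (hij : i ≤ j) (hj : j ≤ D.k) : D.t i ≤ D.t j := by
  induction j, hij using Nat.le_induction with
  | base => exact le_rfl
  | succ j _ ih => exact (ih (by omega)).trans (D.hmono j (by omega))

lemma AdmissibleData.le_t {L1 L2 : ℝ → Submodule ℝ E} (D : AdmissibleData ω a b L1 L2)
    {j : ℕ} (hj : j ≤ D.k) : a ≤ D.t j :=
  D.ht0.symm.le.trans (D.t_le_t (Nat.zero_le j) hj)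

lemma AdmissibleData.t_le {L1 L2 : ℝ → Submodule ℝ E} (D : AdmissibleData ω a b L1 L2)
    {j : ℕ} (hj : j ≤ D.k) : D.t j ≤ b :=
  (D.t_le_t hj le_rfl).trans D.htk.le

/-- `G` is a primitive on `[a, c]` of the increments of the signatures computed from the
Lagrangian subspaces transverse to the path `A` and to `B`. -/
def IsIndexPrimitive (ω : BilinForm ℝ E) (a c : ℝ) (A : ℝ → Submodule ℝ E) (B : Submodule ℝ E)
    (G : ℝ → ℤ) : Prop :=
  ∀ u v : ℝ, ∀ N : Submodule ℝ E, a ≤ u → u ≤ v → v ≤ c → IsLagrangian ω N → N ⊓ B = ⊥ →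
    (∀ t ∈ Set.Icc u v, N ⊓ A t = ⊥) →
    G v - G u = tripleSig ω (A u) B N - tripleSig ω (A v) B N

lemma IsIndexPrimitive.extend [FiniteDimensional ℝ E] (halt : LinearMap.IsAlt ω)
    (hnd : ω.Nondegenerate) {A : ℝ → Submodule ℝ E} (hA : IsLagrangianPath ω a b A)
    {B M : Submodule ℝ E} (hB : IsLagrangian ω B) (hM : IsLagrangian ω M) (hMB : M ⊓ B = ⊥)
    {c d : ℝ} (hac : a ≤ c) (hdb : d ≤ b) (hMA : ∀ t ∈ Set.Icc c d, M ⊓ A t = ⊥)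
    {G : ℝ → ℤ} (hG : IsIndexPrimitive ω a c A B G) :
    ∃ G' : ℝ → ℤ, IsIndexPrimitive ω a d A B G' := by
  let G' : ℝ → ℤ := fun t =>
    if t ≤ c then G t else G c + (tripleSig ω (A c) B M - tripleSig ω (A t) B M)
  have h1 : ∀ t, t ≤ c → G' t = G t := fun t ht => if_pos ht
  have h2 : ∀ t, c ≤ t → G' t = G c + (tripleSig ω (A c) B M - tripleSig ω (A t) B M) := by
    intro t ht
    rcases ht.eq_or_lt with rfl | ht
    · rw [h1 c le_rfl]; ring
    · exact if_neg ht.not_ge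
  refine ⟨G', ?_⟩
  intro u v N hau huv hvd hN hNB hNA
  have right : ∀ x, c ≤ x → u ≤ x → x ≤ v → G' v - G' x =
      tripleSig ω (A x) B N - tripleSig ω (A v) B N := by
    intro x hcx hux hxv
    rw [h2 x hcx, h2 v (hcx.trans hxv)]
    have := tripleSig_sub_eq_of_transverse halt hnd hA hB hN hM hNB hMB (hac.trans hcx) hxv
      (hvd.trans hdb) (fun t ht => hNA t ⟨hux.trans ht.1, ht.2⟩)
      (fun t ht => hMA t ⟨hcx.trans ht.1, ht.2.trans hvd⟩)
    linarith
  rcases le_total v c with hvc | hcv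
  · rw [h1 v hvc, h1 u (huv.trans hvc)]
    exact hG u v N hau huv hvc hN hNB hNA
  rcases le_total u c with huc | hcu
  · have hr := right c le_rfl huc hcv
    have hl := hG u c N hau huc le_rfl hN hNB fun t ht => hNA t ⟨ht.1, ht.2.trans hcv⟩
    rw [h1 c le_rfl] at hr
    rw [h1 u huc]
    linarith
  · exact right u hcu le_rfl huv

lemma AdmissibleData.exists_primitive [FiniteDimensional ℝ E] (halt : LinearMap.IsAlt ω)
    (hnd : ω.Nondegenerate) {A : ℝ → Submodule ℝ E} (hA : IsLagrangianPath ω a b A)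
    {B : Submodule ℝ E} (hB : IsLagrangian ω B) (D : AdmissibleData ω a b A fun _ => B) :
    ∃ G : ℝ → ℤ, IsIndexPrimitive ω a b A B G := by
  suffices h : ∀ n ≤ D.k, ∃ G : ℝ → ℤ, IsIndexPrimitive ω a (D.t n) A B G by
    simpa only [D.htk] using h D.k le_rfl
  intro n
  induction n with
  | zero =>
    intro _
    refine ⟨0, fun u v N hau huv hv _ _ _ => ?_⟩
    rw [D.ht0] at hv
    obtain rfl : u = v := by linarith
    simp
  | succ n ih =>
    intro hn
    obtain ⟨G, hG⟩ := ih (by omega)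
    exact hG.extend halt hnd hA hB (D.hlag n hn)
      (D.htrans2 n hn _ ⟨le_rfl, D.hmono n hn⟩) (D.le_t (by omega)) (D.t_le hn)
      (D.htrans1 n hn)

lemma AdmissibleData.dataSum_eq {A : ℝ → Submodule ℝ E} {B : Submodule ℝ E}
    (D : AdmissibleData ω a b A fun _ => B) {G : ℝ → ℤ} (hG : IsIndexPrimitive ω a b A B G) :
    dataSum D = (1 / 2 : ℝ) * (G b - G a) := by
  have h : ∀ ν ∈ Finset.range D.k, (tripleSig ω (A (D.t ν)) B (D.M (ν + 1)) : ℝ) -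
      (tripleSig ω (A (D.t (ν + 1))) B (D.M (ν + 1)) : ℝ) =
      (G (D.t (ν + 1)) : ℝ) - (G (D.t ν) : ℝ) := by
    intro ν hν
    rw [Finset.mem_range] at hν
    exact_mod_cast (hG (D.t ν) (D.t (ν + 1)) (D.M (ν + 1)) (D.le_t hν.le) (D.hmono ν hν)
      (D.t_le hν) (D.hlag ν hν) (D.htrans2 ν hν _ ⟨le_rfl, D.hmono ν hν⟩)
      (D.htrans1 ν hν)).symm
  rw [dataSum, Finset.sum_congr rfl h, Finset.sum_range_sub (fun ν => (G (D.t ν) : ℝ)), D.htk,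
    D.ht0]

/-- The intersection number with a constant path does not depend on the admissible data. -/
lemma dataSum_eq_dataSum [FiniteDimensional ℝ E] (halt : LinearMap.IsAlt ω)
    (hnd : ω.Nondegenerate) {A : ℝ → Submodule ℝ E} (hA : IsLagrangianPath ω a b A)
    {B : Submodule ℝ E} (hB : IsLagrangian ω B) (D D' : AdmissibleData ω a b A fun _ => B) :
    dataSum D = dataSum D' := by
  obtain ⟨G, hG⟩ := D.exists_primitive halt hnd hA hB
  rw [D.dataSum_eq hG, D'.dataSum_eq hG]

end Independence

section Homotopy

variable {ω : BilinForm ℝ E} {a b : ℝ} {H : ℝ → ℝ → Submodule ℝ E}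

lemma IsLagrangianHomotopy.isLagrangianPath (hH : IsLagrangianHomotopy ω a b H) {s : ℝ}
    (hs : s ∈ Set.Icc (0 : ℝ) 1) : IsLagrangianPath ω a b (H s) where
  lag := hH.lag s hs
  locTriv t ht := by
    obtain ⟨U, hU, hUS, P, hP, hPA⟩ := hH.locTriv (s, t) ⟨hs, ht⟩
    have hc : Continuous fun τ : ℝ => (s, τ) := by fun_prop
    refine ⟨(fun τ => (s, τ)) ⁻¹' U, ?_, fun τ hτ => (hUS hτ).2, fun τ => P (s, τ),
      hP.comp hc.continuousOn fun τ hτ => hτ, fun τ hτ => hPA (s, τ) hτ⟩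
    have hmaps : Set.MapsTo (fun τ : ℝ => (s, τ)) (Set.Icc a b)
        (Set.Icc (0 : ℝ) 1 ×ˢ Set.Icc a b) := fun τ hτ => ⟨hs, hτ⟩
    exact hc.continuousWithinAt.tendsto_nhdsWithin hmaps hU

/-- Admissible data for one path of a homotopy can be chosen to remain admissible for all the
nearby paths. -/
lemma IsLagrangianHomotopy.exists_stable_data [FiniteDimensional ℝ E] (halt : LinearMap.IsAlt ω)
    (hnd : ω.Nondegenerate) (hab : a ≤ b) (hH : IsLagrangianHomotopy ω a b H)
    {B : Submodule ℝ E} (hB : IsLagrangian ω B) (s₀ : Set.Icc (0 : ℝ) 1) :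
    ∃ D₀ : AdmissibleData ω a b (H s₀) fun _ => B, ∀ᶠ s : Set.Icc (0 : ℝ) 1 in 𝓝 s₀,
      ∃ D : AdmissibleData ω a b (H s) fun _ => B, D.k = D₀.k ∧ D.t = D₀.t ∧ D.M = D₀.M := by
  have hloc : ∀ τ : Set.Icc a b, ∃ N : Submodule ℝ E, IsLagrangian ω N ∧ N ⊓ B = ⊥ ∧
      ∃ u : Set (Set.Icc (0 : ℝ) 1), ∃ v : Set (Set.Icc a b), u ∈ 𝓝 s₀ ∧ IsOpen v ∧ τ ∈ v ∧
        ∀ s ∈ u, ∀ σ ∈ v, N ⊓ H s σ = ⊥ := by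
    intro τ
    obtain ⟨N, hN, hNA, hNB⟩ :=
      (hH.lag s₀ s₀.2 τ τ.2).exists_transversal halt hnd hB
    refine ⟨N, hN, hNB, ?_⟩
    have h := (hH.continuousSubspaceAt (s₀, τ)).eventually_inf_eq_bot hNA
    obtain ⟨u, v, hu, hsu, hv, hτv, huv⟩ := mem_nhds_prod_iff'.1 h
    exact ⟨u, v, hu.mem_nhds hsu, hv, hτv, fun s hs σ hσ => huv (Set.mk_mem_prod hs hσ)⟩
  choose N hN hNB u v hu hv hτv huv using hloc
  obtain ⟨t, ht0, htmono, ⟨m, hm⟩, hcov⟩ := exists_monotone_Icc_subset_open_cover_Icc hab hv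
    fun τ _ => Set.mem_iUnion_of_mem τ (hτv τ)
  choose i hi using hcov
  have hev : ∀ᶠ s in 𝓝 s₀, ∀ ν ∈ Finset.range (m + 1), s ∈ u (i ν) :=
    (Filter.eventually_all_finset _).2 fun ν _ => hu (i ν)
  have data : ∀ s : Set.Icc (0 : ℝ) 1, (∀ ν ∈ Finset.range (m + 1), s ∈ u (i ν)) →
      ∃ D : AdmissibleData ω a b (H s) fun _ => B, D.k = m + 1 ∧ D.t = (fun ν => (t ν : ℝ)) ∧
        D.M = fun ν => N (i (ν - 1)) := by
    intro s hs
    refine ⟨⟨m + 1, Nat.succ_pos m, fun ν => t ν, fun ν => N (i (ν - 1)), ht0,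
      hm (m + 1) (Nat.le_succ m), fun ν _ => htmono (Nat.le_succ ν), fun ν _ => hN _, ?_,
      fun ν _ _ _ => hNB _⟩, rfl, rfl, rfl⟩
    intro ν hν σ hσ
    have hσ' : σ ∈ Set.Icc a b := ⟨(t ν).2.1.trans hσ.1, hσ.2.trans (t (ν + 1)).2.2⟩
    exact huv (i ν) s (hs ν (Finset.mem_range.2 hν)) ⟨σ, hσ'⟩ (hi ν ⟨hσ.1, hσ.2⟩)
  obtain ⟨D₀, hk, ht, hM⟩ := data s₀ hev.self_of_nhds
  refine ⟨D₀, ?_⟩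
  filter_upwards [hev] with s hs
  rw [hk, ht, hM]
  exact data s hs

/-- The partial sums defining the intersection number, corrected by the signature at the current
point of the partition, are locally constant along a homotopy fixing the initial point. -/
lemma AdmissibleData.eventually_partialSum_eq [FiniteDimensional ℝ E] (halt : LinearMap.IsAlt ω)
    (hnd : ω.Nondegenerate) (hH : IsLagrangianHomotopy ω a b H) {B : Submodule ℝ E}
    (hB : IsLagrangian ω B) {s₀ : Set.Icc (0 : ℝ) 1}
    (hHa : ∀ s ∈ Set.Icc (0 : ℝ) 1, H s a = H s₀ a)
    (D : AdmissibleData ω a b (H s₀) fun _ => B) {j : ℕ} (hj : j ≤ D.k) {N : Submodule ℝ E}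
    (hN : IsLagrangian ω N) (hNB : N ⊓ B = ⊥) (hNA : N ⊓ H s₀ (D.t j) = ⊥) :
    ∀ᶠ s : Set.Icc (0 : ℝ) 1 in 𝓝 s₀,
      ∑ ν ∈ Finset.range j, (tripleSig ω (H s (D.t ν)) B (D.M (ν + 1)) -
        tripleSig ω (H s (D.t (ν + 1))) B (D.M (ν + 1))) + tripleSig ω (H s (D.t j)) B N =
      ∑ ν ∈ Finset.range j, (tripleSig ω (H s₀ (D.t ν)) B (D.M (ν + 1)) -
        tripleSig ω (H s₀ (D.t (ν + 1))) B (D.M (ν + 1))) +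
        tripleSig ω (H s₀ (D.t j)) B N := by
  induction j generalizing N with
  | zero =>
    refine Filter.Eventually.of_forall fun s => ?_
    simp only [Finset.range_zero, Finset.sum_empty, D.ht0, hHa s s.2]
  | succ j ih =>
    have hM := D.hlag j hj
    have hMB := D.htrans2 j hj _ ⟨le_rfl, D.hmono j hj⟩
    have hτ : D.t (j + 1) ∈ Set.Icc a b := ⟨D.le_t hj, D.t_le hj⟩
    have hcont : ContinuousSubspaceAt (fun s : Set.Icc (0 : ℝ) 1 => H s (D.t (j + 1))) s₀ :=
      (hH.continuousSubspaceAt (s₀, ⟨_, hτ⟩)).comp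
        (f := fun s : Set.Icc (0 : ℝ) 1 => (s, (⟨_, hτ⟩ : Set.Icc a b))) (by fun_prop)
    filter_upwards [ih (by omega) hM hMB (D.htrans1 j hj _ ⟨le_rfl, D.hmono j hj⟩),
      hcont.eventually_tripleSig_sub_eq halt hnd (fun s => hH.lag s s.2 _ hτ) hB hM hN
        (D.htrans1 j hj _ ⟨D.hmono j hj, le_rfl⟩) hNA hMB hNB] with s h1 h2
    rw [Finset.sum_range_succ, Finset.sum_range_succ]
    linarith

lemma IsLagrangianHomotopy.exists_data_eventually_dataSum_eq [FiniteDimensional ℝ E]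
    (halt : LinearMap.IsAlt ω) (hnd : ω.Nondegenerate) (hab : a ≤ b)
    (hH : IsLagrangianHomotopy ω a b H) {B : Submodule ℝ E} (hB : IsLagrangian ω B)
    (s₀ : Set.Icc (0 : ℝ) 1) (hHa : ∀ s ∈ Set.Icc (0 : ℝ) 1, H s a = H s₀ a)
    (hHb : ∀ s ∈ Set.Icc (0 : ℝ) 1, H s b = H s₀ b) :
    ∃ D₀ : AdmissibleData ω a b (H s₀) fun _ => B, ∀ᶠ s : Set.Icc (0 : ℝ) 1 in 𝓝 s₀,
      ∃ D : AdmissibleData ω a b (H s) fun _ => B, dataSum D = dataSum D₀ := by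
  obtain ⟨D₀, hD⟩ := hH.exists_stable_data halt hnd hab hB s₀
  refine ⟨D₀, ?_⟩
  obtain ⟨n, hn⟩ := Nat.exists_eq_succ_of_ne_zero D₀.kpos.ne'
  have hnk : n < D₀.k := by omega
  have hlast : D₀.t D₀.k ∈ Set.Icc (D₀.t n) (D₀.t (n + 1)) := by
    rw [hn]; exact ⟨D₀.hmono n hnk, le_rfl⟩
  filter_upwards [hD, D₀.eventually_partialSum_eq halt hnd hH hB hHa le_rfl (D₀.hlag n hnk)
    (D₀.htrans2 n hnk _ hlast) (D₀.htrans1 n hnk _ hlast)] with s ⟨D, hk, ht, hM⟩ hs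
  refine ⟨D, ?_⟩
  rw [D₀.htk, hHb s s.2, add_left_inj] at hs
  rw [dataSum, dataSum, hk, ht, hM]
  exact congrArg ((1 / 2 : ℝ) * ·) (by exact_mod_cast hs)

end Homotopy

/-- well-definedness of the Leray index: if two continuous paths of Lagrangian
subspaces with the same endpoints are homotopic with endpoints fixed, then they have the same
intersection number with the constant path at the common final point (computed from arbitrary
admissible data). -/
theorem leray_index_well_defined [FiniteDimensional ℝ E]
    (ω : BilinForm ℝ E) (halt : LinearMap.IsAlt ω)
    (hnd : LinearMap.BilinForm.Nondegenerate ω)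
    (a b : ℝ) (hab : a ≤ b)
    (L L' : ℝ → Submodule ℝ E)
    (hL : IsLagrangianPath ω a b L) (hL' : IsLagrangianPath ω a b L')
    (hea : L' a = L a) (heb : L' b = L b)
    (H : ℝ → ℝ → Submodule ℝ E) (hH : IsLagrangianHomotopy ω a b H)
    (hH0 : H 0 = L) (hH1 : H 1 = L')
    (hHa : ∀ s ∈ Set.Icc (0:ℝ) 1, H s a = L a)
    (hHb : ∀ s ∈ Set.Icc (0:ℝ) 1, H s b = L b)
    (D : AdmissibleData ω a b L (fun _ => L b))
    (D' : AdmissibleData ω a b L' (fun _ => L b)) :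
    dataSum D = dataSum D' := by
  have hB : IsLagrangian ω (L b) := hL.lag b ⟨hab, le_rfl⟩
  subst hH0 hH1
  have hloc := fun s₀ : Set.Icc (0 : ℝ) 1 =>
    hH.exists_data_eventually_dataSum_eq halt hnd hab hB s₀
      (fun s hs => (hHa s hs).trans (hHa s₀ s₀.2).symm)
      (fun s hs => (hHb s hs).trans (hHb s₀ s₀.2).symm)
  choose D₀ hD₀ using hloc
  have hconst : IsLocallyConstant fun s => dataSum (D₀ s) := by
    rw [IsLocallyConstant.iff_eventually_eq]
    intro s₀
    filter_upwards [hD₀ s₀] with s ⟨Ds, hDs⟩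
    rw [← hDs]
    exact dataSum_eq_dataSum halt hnd (hH.isLagrangianPath s.2) hB (D₀ s) Ds
  have : PreconnectedSpace (Set.Icc (0 : ℝ) 1) := Subtype.preconnectedSpace isPreconnected_Icc
  calc dataSum D = dataSum (D₀ ⟨0, le_rfl, zero_le_one⟩) :=
        dataSum_eq_dataSum halt hnd hL hB _ _
    _ = dataSum (D₀ ⟨1, zero_le_one, le_rfl⟩) := hconst.apply_eq_of_preconnectedSpace _ _
    _ = dataSum D' := dataSum_eq_dataSum halt hnd hL' hB _ _
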